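/- arXiv:1008.3587 — 2 statements merged into one kernel-verified Lean document; each statement's English description precedes it below -/
import Mathlib

section
/- Let ℏ > 0 and ε ∈ ℝ. For x = (x₁,x₂), y = (y₁,y₂) ∈ ℝ² and t ∈ ℝ with sin t ≠ 0 define the phase φ̄(x,y,t) = −(1/4)·cot t·(x₁−y₁)² + (1/2)·(x₁+y₁+2ε)·(x₂−y₂+2tε) − (1/4)·cot t·(x₂−y₂+2tε)² − t·ε², and the kernel U(x,y,t) = (i/(4πℏ))·csc t·exp(i·φ̄(x,y,t)/ℏ). Then at every such point ∂U/∂t = (i/ℏ)·( −ℏ²·∂²U/∂x₁² − ℏ²·∂²U/∂x₂² + 2iℏ·x₁·∂U/∂x₂ + x₁²·U + 2ε·x₁·U ). That is, the explicit kernel (16.1.9)–(16.1.10) of Proposition 16.1.1 solves the time-dependent Schrödinger equation ∂ₜU = iℏ⁻¹Ā_xU of the rescaled pilot-model operator Ā = ℏ²D₁² + (ℏD₂ − x₁)² + 2εx₁ on every time interval where sin t ≠ 0. -/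
/-- The phase `φ̄(x,y,t)` of (16.1.10) for the rescaled 2D pilot-model operator,
with `ε = αμ⁻¹`. -/
noncomputable def pilotPhase (ε : ℝ) (x₁ x₂ y₁ y₂ t : ℝ) : ℝ :=
  -(1/4) * (Real.cos t / Real.sin t) * (x₁ - y₁)^2
    + (1/2) * (x₁ + y₁ + 2*ε) * (x₂ - y₂ + 2*t*ε)
    - (1/4) * (Real.cos t / Real.sin t) * (x₂ - y₂ + 2*t*ε)^2
    - t * ε^2

/-- The explicit propagator kernel `U(x,y,t)` of (16.1.9)
(without the immaterial density factor `μ²`). -/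
noncomputable def pilotKernel (ℏ ε : ℝ) (x₁ x₂ y₁ y₂ t : ℝ) : ℂ :=
  (Complex.I / (4 * (Real.pi : ℂ) * (ℏ : ℂ))) * ((Real.sin t)⁻¹ : ℝ) *
    Complex.exp (Complex.I * ((pilotPhase ε x₁ x₂ y₁ y₂ t : ℝ) : ℂ) / (ℏ : ℂ))

theorem hasDerivAt_cexp_I_mul_div {f : ℝ → ℝ} {f' x : ℝ} (h : ℝ) (hf : HasDerivAt f f' x) :
    HasDerivAt (fun s => Complex.exp (Complex.I * ((f s : ℝ) : ℂ) / (h : ℂ)))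
      (Complex.exp (Complex.I * ((f x : ℝ) : ℂ) / (h : ℂ)) * (Complex.I * (f' : ℂ) / (h : ℂ))) x :=
  ((hf.ofReal_comp.const_mul Complex.I).div_const (h : ℂ)).cexp

/-- The second derivative of an oscillating exponential with constant amplitude. -/
theorem deriv_deriv_const_mul_cexp_I_mul_div {f f' : ℝ → ℝ} {c x : ℝ} (h : ℝ) (A : ℂ)
    (hf : ∀ y, HasDerivAt f (f' y) y) (hf' : HasDerivAt f' c x) :
    deriv (fun a => deriv (fun b =>
        A * Complex.exp (Complex.I * ((f b : ℝ) : ℂ) / (h : ℂ))) a) x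
      = A * Complex.exp (Complex.I * ((f x : ℝ) : ℂ) / (h : ℂ)) *
        (Complex.I * (c : ℂ) / (h : ℂ) + (Complex.I * (f' x : ℂ) / (h : ℂ)) ^ 2) := by
  have h₁ : (fun a => deriv (fun b =>
      A * Complex.exp (Complex.I * ((f b : ℝ) : ℂ) / (h : ℂ))) a) = fun a =>
      A * (Complex.exp (Complex.I * ((f a : ℝ) : ℂ) / (h : ℂ)) *
        (Complex.I * (f' a : ℂ) / (h : ℂ))) :=
    funext fun a => ((hasDerivAt_cexp_I_mul_div h (hf a)).const_mul A).deriv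
  rw [h₁]
  refine (((hasDerivAt_cexp_I_mul_div h (hf x)).mul
    ((hf'.ofReal_comp.const_mul Complex.I).div_const (h : ℂ))).const_mul A).deriv.trans ?_
  ring

theorem hasDerivAt_pilotPhase_fst (ε x₂ y₁ y₂ t x : ℝ) :
    HasDerivAt (fun b => pilotPhase ε b x₂ y₁ y₂ t)
      (-(1/2) * (Real.cos t / Real.sin t) * (x - y₁) + (1/2) * (x₂ - y₂ + 2*t*ε)) x := by
  unfold pilotPhase
  have h := hasDerivAt_id' x
  refine HasDerivAt.congr_deriv
    ((((((h.sub_const y₁).pow 2).const_mul (-(1/4) * (Real.cos t / Real.sin t))).add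
    ((((h.add_const y₁).add_const (2*ε)).const_mul (1/2)).mul_const (x₂ - y₂ + 2*t*ε))).sub_const
    ((1/4) * (Real.cos t / Real.sin t) * (x₂ - y₂ + 2*t*ε)^2)).sub_const (t * ε^2)) ?_
  push_cast
  ring

theorem hasDerivAt_pilotPhase_snd (ε x₁ y₁ y₂ t x : ℝ) :
    HasDerivAt (fun b => pilotPhase ε x₁ b y₁ y₂ t)
      ((1/2) * (x₁ + y₁ + 2*ε) - (1/2) * (Real.cos t / Real.sin t) * (x - y₂ + 2*t*ε)) x := by
  unfold pilotPhase
  have h := ((hasDerivAt_id' x).sub_const y₂).add_const (2*t*ε)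
  refine HasDerivAt.congr_deriv
    ((((h.const_mul ((1/2) * (x₁ + y₁ + 2*ε))).const_add
    (-(1/4) * (Real.cos t / Real.sin t) * (x₁ - y₁)^2)).sub
    ((h.pow 2).const_mul ((1/4) * (Real.cos t / Real.sin t)))).sub_const (t * ε^2)) ?_
  push_cast
  ring

theorem hasDerivAt_pilotPhase_time (ε x₁ x₂ y₁ y₂ : ℝ) {t : ℝ} (ht : Real.sin t ≠ 0) :
    HasDerivAt (fun s => pilotPhase ε x₁ x₂ y₁ y₂ s)
      ((1/4) * (1 + (Real.cos t / Real.sin t)^2) * ((x₁ - y₁)^2 + (x₂ - y₂ + 2*t*ε)^2)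
        + ε * (x₁ + y₁ + 2*ε) - ε * (Real.cos t / Real.sin t) * (x₂ - y₂ + 2*t*ε) - ε^2) t := by
  unfold pilotPhase
  have hc := (Real.hasDerivAt_cos t).div (Real.hasDerivAt_sin t) ht
  have hv := (((hasDerivAt_id' t).const_mul 2).mul_const ε).const_add (x₂ - y₂)
  refine HasDerivAt.congr_deriv
    (((((hc.const_mul (-(1/4))).mul_const ((x₁ - y₁)^2)).add
    (hv.const_mul ((1/2) * (x₁ + y₁ + 2*ε)))).sub
    ((hc.const_mul (1/4)).mul (hv.pow 2))).sub ((hasDerivAt_id' t).mul_const (ε^2))) ?_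
  simp only [Pi.div_apply, Pi.pow_apply]
  field_simp
  ring

/-- Proposition 16.1.1: the explicit kernel (16.1.9)–(16.1.10) solves the time-dependent
Schrödinger equation `∂ₜU = iℏ⁻¹ Ā_x U` of the rescaled pilot-model operator
`Ā = ℏ²D₁² + (ℏD₂ − x₁)² + 2εx₁` at every point where `sin t ≠ 0`. -/
theorem pilot_model_kernel_solves_schrodinger
    (ℏ ε : ℝ) (hℏ : 0 < ℏ) (x₁ x₂ y₁ y₂ t : ℝ) (ht : Real.sin t ≠ 0) :
    deriv (fun s => pilotKernel ℏ ε x₁ x₂ y₁ y₂ s) t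
      = (Complex.I / (ℏ : ℂ)) *
        ( -(ℏ : ℂ)^2 * deriv (fun a => deriv (fun b => pilotKernel ℏ ε b x₂ y₁ y₂ t) a) x₁
          - (ℏ : ℂ)^2 * deriv (fun a => deriv (fun b => pilotKernel ℏ ε x₁ b y₁ y₂ t) a) x₂
          + 2 * Complex.I * (ℏ : ℂ) * (x₁ : ℂ) *
              deriv (fun b => pilotKernel ℏ ε x₁ b y₁ y₂ t) x₂
          + (x₁ : ℂ)^2 * pilotKernel ℏ ε x₁ x₂ y₁ y₂ t
          + 2 * (ε : ℂ) * (x₁ : ℂ) * pilotKernel ℏ ε x₁ x₂ y₁ y₂ t ) := by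
  have hh : (ℏ : ℂ) ≠ 0 := Complex.ofReal_ne_zero.mpr hℏ.ne'
  have hφ₁₁ : HasDerivAt (fun x => -(1/2) * (Real.cos t / Real.sin t) * (x - y₁)
      + (1/2) * (x₂ - y₂ + 2*t*ε)) (-(1/2) * (Real.cos t / Real.sin t)) x₁ := by
    simpa using (((hasDerivAt_id' x₁).sub_const y₁).const_mul
      (-(1/2) * (Real.cos t / Real.sin t))).add_const ((1/2) * (x₂ - y₂ + 2*t*ε))
  have hφ₂₂ : HasDerivAt (fun x => (1/2) * (x₁ + y₁ + 2*ε)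
      - (1/2) * (Real.cos t / Real.sin t) * (x - y₂ + 2*t*ε))
      (-((1/2) * (Real.cos t / Real.sin t))) x₂ := by
    simpa using ((((hasDerivAt_id' x₂).sub_const y₂).add_const (2*t*ε)).const_mul
      ((1/2) * (Real.cos t / Real.sin t))).const_sub ((1/2) * (x₁ + y₁ + 2*ε))
  have hA := (((Real.hasDerivAt_sin t).inv ht).ofReal_comp).const_mul
    (Complex.I / (4 * (Real.pi : ℂ) * (ℏ : ℂ)))
  have hUt := (hA.mul (hasDerivAt_cexp_I_mul_div ℏ
    (hasDerivAt_pilotPhase_time ε x₁ x₂ y₁ y₂ ht))).deriv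
  have hU₁₁ := deriv_deriv_const_mul_cexp_I_mul_div ℏ
    (Complex.I / (4 * (Real.pi : ℂ) * (ℏ : ℂ)) * ((Real.sin t)⁻¹ : ℝ))
    (hasDerivAt_pilotPhase_fst ε x₂ y₁ y₂ t) hφ₁₁
  have hU₂₂ := deriv_deriv_const_mul_cexp_I_mul_div ℏ
    (Complex.I / (4 * (Real.pi : ℂ) * (ℏ : ℂ)) * ((Real.sin t)⁻¹ : ℝ))
    (hasDerivAt_pilotPhase_snd ε x₁ y₁ y₂ t) hφ₂₂
  have hU₂ := ((hasDerivAt_cexp_I_mul_div ℏ (hasDerivAt_pilotPhase_snd ε x₁ y₁ y₂ t x₂)).const_mul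
    (Complex.I / (4 * (Real.pi : ℂ) * (ℏ : ℂ)) * ((Real.sin t)⁻¹ : ℝ))).deriv
  unfold pilotKernel
  rw [hU₁₁, hU₂₂, hU₂]
  refine hUt.trans ?_
  have hs : ((Real.sin t : ℝ) : ℂ) ≠ 0 := Complex.ofReal_ne_zero.mpr ht
  have hπ : (Real.pi : ℂ) ≠ 0 := Complex.ofReal_ne_zero.mpr Real.pi_ne_zero
  have hI : Complex.I ^ 3 = -Complex.I := by rw [pow_succ, Complex.I_sq, neg_one_mul]
  simp only [Pi.inv_apply]
  generalize Complex.exp _ = E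
  push_cast [-Complex.ofReal_sin, -Complex.ofReal_cos]
  generalize ((Real.sin t : ℝ) : ℂ) = σ at *
  generalize ((Real.cos t : ℝ) : ℂ) = κ at *
  field_simp
  ring_nf
  simp only [hI, Complex.I_sq]
  ring
end

section
/- Let ε, τ ∈ ℝ and φ(t) = −ε²t²·cot t + ε²t − tτ. If sin t ≠ 0 and φ′(t) = 0, then φ″(t) = −2τ·cot t + 4ε²·t. (This exact identity underlies claim (16.1.31): at the stationary points t_k one has φ″(t_k) ∼ −2τ·cot(t_k) away from the equatorial zone, since the correction 4ε²t_k is small there.) -/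
/-- The pilot-model loop phase `φ(t) = −ε²t²·cot t + ε²t − tτ` of (16.1.23). -/
noncomputable def loopPhase (ε τ : ℝ) (t : ℝ) : ℝ :=
  -(ε^2) * t^2 * (Real.cos t / Real.sin t) + ε^2 * t - t * τ

theorem hasDerivAt_cos_div_sin {t : ℝ} (ht : Real.sin t ≠ 0) :
    HasDerivAt (fun x => Real.cos x / Real.sin x) (-(1 + (Real.cos t / Real.sin t) ^ 2)) t := by
  refine ((Real.hasDerivAt_cos t).div (Real.hasDerivAt_sin t) ht).congr_deriv ?_
  field_simp
  ring

theorem hasDerivAt_loopPhase (ε τ : ℝ) {t : ℝ} (ht : Real.sin t ≠ 0) :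
    HasDerivAt (loopPhase ε τ)
      (ε ^ 2 * (t ^ 2 * (1 + (Real.cos t / Real.sin t) ^ 2)
        - 2 * t * (Real.cos t / Real.sin t) + 1) - τ) t := by
  have h := (((((hasDerivAt_id' t).pow 2).const_mul (-(ε ^ 2))).mul
    (hasDerivAt_cos_div_sin ht)).add ((hasDerivAt_id' t).const_mul (ε ^ 2))).sub
    ((hasDerivAt_id' t).mul_const τ)
  refine h.congr_deriv ?_
  simp only [Nat.cast_ofNat, Pi.pow_apply]
  ring

theorem hasDerivAt_deriv_loopPhase (ε τ : ℝ) {t : ℝ} (ht : Real.sin t ≠ 0) :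
    HasDerivAt (deriv (loopPhase ε τ))
      (ε ^ 2 * (4 * t * (1 + (Real.cos t / Real.sin t) ^ 2) - 2 * (Real.cos t / Real.sin t)
        - 2 * t ^ 2 * (Real.cos t / Real.sin t) * (1 + (Real.cos t / Real.sin t) ^ 2))) t := by
  have hcot := hasDerivAt_cos_div_sin ht
  have h := (((((((hasDerivAt_id' t).pow 2).mul ((hcot.pow 2).const_add 1)).sub
    (((hasDerivAt_id' t).const_mul 2).mul hcot)).add_const 1).const_mul (ε ^ 2)).sub_const τ)
  have hev : ∀ᶠ x in nhds t, Real.sin x ≠ 0 := Real.continuous_sin.continuousAt.eventually_ne ht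
  refine (h.congr_deriv ?_).congr_of_eventuallyEq
    (hev.mono fun x hx => (hasDerivAt_loopPhase ε τ hx).deriv)
  simp only [Nat.cast_ofNat, Pi.pow_apply]
  ring


/-- The exact identity underlying claim (16.1.31): at a stationary point `t` of `φ`
with `sin t ≠ 0` one has `φ″(t) = −2τ·cot t + 4ε²·t`. -/
theorem loopPhase_second_deriv_at_critical (ε τ t : ℝ) (ht : Real.sin t ≠ 0)
    (hcrit : deriv (loopPhase ε τ) t = 0) :
    deriv (deriv (loopPhase ε τ)) t
      = -2 * τ * (Real.cos t / Real.sin t) + 4 * ε^2 * t := by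
  rw [(hasDerivAt_loopPhase ε τ ht).deriv] at hcrit
  rw [(hasDerivAt_deriv_loopPhase ε τ ht).deriv]
  linear_combination (-2 * (Real.cos t / Real.sin t)) * hcrit
end
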